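/- Let P ⊆ ℝ³ be a convex polyhedron with 0 in its interior and let q be an extreme point (vertex) of P. Then the set { v ∈ ℝ³ : ‖v‖ = 1, ∃ ε > 0 such that q + t·v ∈ ∂P for all t ∈ [0, ε], and ⟪q, v⟫ > 0 } is a preconnected subset of ℝ³; that is, the set of boundary-tangent directions at a vertex along which the radial distance function strictly increases is connected. -/

import Mathlib

open scoped RealInnerProductSpace

/-- Local conicity of a polytope near one of its vertices. -/
lemma vertex_local_cone {E : Type*} [NormedAddCommGroup E] [InnerProductSpace ℝ E]
    [FiniteDimensional ℝ E]
    (S : Set E) (hSfin : S.Finite) (q : E) (hq : q ∈ Set.extremePoints ℝ (convexHull ℝ S))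
    (hq0 : q ≠ 0) (h0 : (0 : E) ∈ convexHull ℝ S) :
    ∃ δ > (0 : ℝ), ∀ x : E, ∀ t > (0 : ℝ), q + t • x ∈ convexHull ℝ S → ‖x‖ ≤ δ →
      q + x ∈ convexHull ℝ S := by
  have hqS : q ∈ S := extremePoints_convexHull_subset hq
  have hins : insert q (S \ {q}) = S := by
    ext y; by_cases h : y = q <;> simp [h, hqS]
  have hne : (S \ {q}).Nonempty := by
    by_contra h
    rw [Set.not_nonempty_iff_eq_empty] at h
    rw [h] at hins
    rw [← hins] at h0
    simp at h0
    exact hq0 h0.symm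
  have hK : IsCompact (convexHull ℝ (S \ {q})) := (hSfin.subset Set.sdiff_subset).isCompact_convexHull ℝ
  have hKn : (convexHull ℝ (S \ {q})).Nonempty := hne.convexHull
  have hqK : q ∉ convexHull ℝ (S \ {q}) := by
    intro h
    have h2 : q ∈ Set.extremePoints ℝ (convexHull ℝ (S \ {q})) :=
      inter_extremePoints_subset_extremePoints_of_subset (convexHull_mono Set.sdiff_subset) ⟨h, hq⟩
    exact (extremePoints_convexHull_subset h2).2 rfl
  have hδ := (hK.isClosed.notMem_iff_infDist_pos hKn).1 hqK
  refine ⟨_, hδ, ?_⟩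
  intro x t ht hx hxn
  have hsub : convexHull ℝ (S \ {q}) ⊆ convexHull ℝ S := convexHull_mono Set.sdiff_subset
  have hx' := hx
  rw [← hins, convexHull_insert hne, mem_convexJoin] at hx'
  obtain ⟨a, ha, k, hk, hseg⟩ := hx'
  rw [Set.mem_singleton_iff] at ha
  subst ha
  rw [segment_eq_image'] at hseg
  obtain ⟨b, ⟨hb0, hb1⟩, hb⟩ := hseg
  have hb' : b • (k - a) = t • x := by simpa using hb
  have hxe : x = (b / t) • (k - a) := by
    rw [div_eq_inv_mul, mul_smul, hb', smul_smul, inv_mul_cancel₀ ht.ne', one_smul]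
  have hkn : Metric.infDist a (convexHull ℝ (S \ {a})) ≤ ‖k - a‖ := by
    rw [← dist_eq_norm, dist_comm]; exact Metric.infDist_le_dist_of_mem hk
  have hbt : 0 ≤ b / t := by positivity
  have hle : b / t ≤ 1 := by
    rw [hxe, norm_smul, Real.norm_of_nonneg hbt] at hxn
    by_contra hcon
    push Not at hcon
    nlinarith
  have : a + x ∈ segment ℝ a k := by
    rw [segment_eq_image', hxe]
    exact ⟨b / t, ⟨hbt, hle⟩, rfl⟩
  exact (convex_convexHull ℝ S).segment_subset (subset_convexHull ℝ S hqS) (hsub hk) this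

/-- The purely conical statement. -/
lemma cone_part {E : Type*} [NormedAddCommGroup E] [InnerProductSpace ℝ E]
    [FiniteDimensional ℝ E] (C : Set E) (hC : IsClosed C)
    (hadd : ∀ x ∈ C, ∀ y ∈ C, x + y ∈ C) (hsmul : ∀ c > (0 : ℝ), ∀ x ∈ C, c • x ∈ C)
    (q : E) (hqC : q ∉ C) (ρ : ℝ) (hρ : 0 < ρ) (hint : ∀ x : E, ‖x‖ ≤ ρ → -q + x ∈ C) :
    IsPreconnected {v : E | ‖v‖ = 1 ∧ (v ∈ C ∧ ∀ s > (0 : ℝ), v + s • q ∉ C) ∧ 0 < ⟪q, v⟫} := by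
  have h0C : (0 : E) ∈ C := by
    have h1 : -q ∈ C := by simpa using hint 0 (by simpa using hρ.le)
    have : ∀ n : ℕ, (1 / ((n : ℝ) + 1)) • (-q) ∈ C := fun n => hsmul _ (by positivity) _ h1
    refine hC.mem_of_tendsto (b := Filter.atTop) ?_ (Filter.Eventually.of_forall this)
    simpa using (tendsto_one_div_add_atTop_nhds_zero_nat (𝕜 := ℝ)).smul_const (-q)
  have hne : ∀ x : E, ∃ s : ℝ, x + s • q ∈ C := by
    intro x
    have hM : 0 < (‖x‖ + 1) / ρ := by positivity
    refine ⟨-((‖x‖ + 1) / ρ), ?_⟩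
    have h1 := hsmul _ hM _ (hint (((‖x‖ + 1) / ρ)⁻¹ • x) (by
      rw [norm_smul, Real.norm_of_nonneg (by positivity), inv_div, div_mul_eq_mul_div,
        div_le_iff₀ (by positivity)]
      nlinarith [norm_nonneg x]))
    rw [smul_add, smul_smul, mul_inv_cancel₀ hM.ne', one_smul] at h1
    convert h1 using 1
    module
  have hbd : ∀ x : E, BddAbove {s : ℝ | x + s • q ∈ C} := by
    intro x
    obtain ⟨r, hr, hball⟩ := Metric.isOpen_iff.1 hC.isOpen_compl q hqC
    refine ⟨‖x‖ / r, ?_⟩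
    intro s hs
    by_contra hcon
    push Not at hcon
    have hs0 : 0 < s := lt_of_le_of_lt (by positivity) hcon
    rw [div_lt_iff₀ hr] at hcon
    have h1 : s⁻¹ • x + q ∈ C := by
      have := hsmul _ (inv_pos.2 hs0) _ hs
      rwa [smul_add, smul_smul, inv_mul_cancel₀ hs0.ne', one_smul] at this
    refine hball ?_ h1
    rw [Metric.mem_ball, dist_eq_norm, add_sub_cancel_right, norm_smul,
      Real.norm_of_nonneg (by positivity), inv_mul_lt_iff₀ hs0]
    exact hcon
  have hcl : ∀ x : E, IsClosed {s : ℝ | x + s • q ∈ C} := fun x =>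
    hC.preimage (by fun_prop)
  obtain ⟨g, hg⟩ : ∃ g : E → ℝ, ∀ x, x + g x • q ∈ C ∧ ∀ s, x + s • q ∈ C → s ≤ g x :=
    ⟨fun x => sSup {s : ℝ | x + s • q ∈ C}, fun x =>
      ⟨(hcl x).csSup_mem (hne x) (hbd x), fun s hs => le_csSup (hbd x) hs⟩⟩
  have hsmul' : ∀ c ≥ (0 : ℝ), ∀ x ∈ C, c • x ∈ C := by
    intro c hc x hx
    rcases hc.eq_or_lt with h | h
    · rw [← h, zero_smul]; exact h0C
    · exact hsmul c h x hx
  have hconc : ConcaveOn ℝ Set.univ g := by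
    refine ⟨convex_univ, ?_⟩
    intro x _ y _ a b ha hb _
    apply (hg _).2
    have := hadd _ (hsmul' a ha _ (hg x).1) _ (hsmul' b hb _ (hg y).1)
    convert this using 1
    simp only [smul_eq_mul]
    module
  have hcont : Continuous g := by
    have := hconc.continuousOn isOpen_univ
    exact continuousOn_univ.1 this
  set D : Set E := {x | 0 < ⟪q, x + g x • q⟫} with hD
  have hDconv : Convex ℝ D := by
    intro x hx y hy a b ha hb hab
    simp only [hD, Set.mem_ofPred_eq, inner_add_right, inner_smul_right] at hx hy ⊢
    have h1 := hconc.2 (Set.mem_univ x) (Set.mem_univ y) ha hb hab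
    simp only [smul_eq_mul] at h1
    have h2 := mul_le_mul_of_nonneg_right h1 (real_inner_self_nonneg (x := q))
    rcases ha.eq_or_lt with h | h
    · have : b = 1 := by linarith
      subst this; subst h
      nlinarith
    · have h3 := mul_pos h hx
      have h4 := mul_nonneg hb hy.le
      nlinarith
  have himg : {v : E | ‖v‖ = 1 ∧ (v ∈ C ∧ ∀ s > (0 : ℝ), v + s • q ∉ C) ∧ 0 < ⟪q, v⟫}
      = (fun x => ‖x + g x • q‖⁻¹ • (x + g x • q)) '' D := by
    ext v
    constructor
    · rintro ⟨h1, ⟨h2, h3⟩, h4⟩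
      have hgv : g v = 0 := by
        apply le_antisymm
        · by_contra h
          push Not at h
          exact h3 _ h (hg v).1
        · exact (hg v).2 0 (by simpa using h2)
      refine ⟨v, ?_, ?_⟩
      · simpa [hD, hgv] using h4
      · simp [hgv, h1]
    · rintro ⟨x, hx, rfl⟩
      have hy0 : x + g x • q ≠ 0 := by
        intro h
        simp only [hD, Set.mem_ofPred_eq, h, inner_zero_right, lt_irrefl] at hx
      have hn : 0 < ‖x + g x • q‖ := norm_pos_iff.2 hy0
      refine ⟨?_, ⟨?_, ?_⟩, ?_⟩
      · simp only [norm_smul, norm_inv, norm_norm]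
        exact inv_mul_cancel₀ hn.ne'
      · exact hsmul _ (inv_pos.2 hn) _ (hg x).1
      · intro s hs hmem
        have h1 := hsmul _ hn _ hmem
        rw [smul_add, smul_smul, mul_inv_cancel₀ hn.ne', one_smul] at h1
        have h2 := (hg x).2 (g x + ‖x + g x • q‖ * s) (by
          convert h1 using 1
          module)
        nlinarith [mul_pos hn hs]
      · simp only [inner_smul_right]
        exact mul_pos (inv_pos.2 hn) hx
  rw [himg]
  refine hDconv.isPreconnected.image _ ?_
  have hc2 : Continuous fun x => x + g x • q := by fun_prop
  refine ContinuousOn.smul (ContinuousOn.inv₀ hc2.norm.continuousOn ?_) hc2.continuousOn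
  intro x hx h
  rw [norm_eq_zero] at h
  simp only [hD, Set.mem_ofPred_eq, h, inner_zero_right, lt_irrefl] at hx

/-- at a vertex (extreme point) `q` of a convex polyhedron `P` with `0` in
its interior, the set of boundary-tangent directions along which the radial distance
function strictly increases is connected. -/
theorem ascent_directions_at_vertex_preconnected
    (S : Set (EuclideanSpace ℝ (Fin 3))) (hSfin : S.Finite)
    (P : Set (EuclideanSpace ℝ (Fin 3))) (hP : P = convexHull ℝ S)
    (h0 : (0 : EuclideanSpace ℝ (Fin 3)) ∈ interior P)
    (q : EuclideanSpace ℝ (Fin 3)) (hq : q ∈ Set.extremePoints ℝ P) :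
    IsPreconnected {v : EuclideanSpace ℝ (Fin 3) | ‖v‖ = 1 ∧
      (∃ ε > (0 : ℝ), ∀ t ∈ Set.Icc (0 : ℝ) ε, q + t • v ∈ frontier P) ∧
      0 < ⟪q, v⟫} := by
  by_cases hq0 : q = 0
  · subst hq0
    simp [isPreconnected_empty]
  have h0P : (0 : EuclideanSpace ℝ (Fin 3)) ∈ P := interior_subset h0
  have hqP : q ∈ P := hq.1
  have hconv : Convex ℝ P := hP ▸ convex_convexHull ℝ S
  have hclosed : IsClosed P := by
    rw [hP]; exact (hSfin.isCompact_convexHull ℝ).isClosed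
  obtain ⟨δ, hδ, hloc⟩ := vertex_local_cone S hSfin q (hP ▸ hq) hq0 (hP ▸ h0P)
  rw [← hP] at hloc
  have hstar : ∀ x : EuclideanSpace ℝ (Fin 3), ∀ t : ℝ, 0 ≤ t → ∀ t' : ℝ, t ≤ t' → q + t' • x ∈ P →
      q + t • x ∈ P := by
    intro x t ht t' htt' hx
    rcases ht.eq_or_lt with h | h
    · rw [← h]; simpa using hqP
    have ht' : 0 < t' := h.trans_le htt'
    have := hconv.add_smul_mem hqP hx (t := t / t') ⟨by positivity, (div_le_one ht').2 htt'⟩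
    rwa [smul_smul, div_mul_cancel₀ _ ht'.ne'] at this
  let C : Set (EuclideanSpace ℝ (Fin 3)) := {x | q + (δ / (1 + ‖x‖)) • x ∈ P}
  have hCiff : ∀ x, x ∈ C ↔ ∃ t > (0 : ℝ), q + t • x ∈ P := by
    intro x
    have hpos : 0 < δ / (1 + ‖x‖) := by positivity
    constructor
    · intro h
      exact ⟨_, hpos, h⟩
    · rintro ⟨t, ht, h⟩
      refine hloc _ (t / (δ / (1 + ‖x‖))) (by positivity) ?_ ?_
      · rwa [smul_smul, div_mul_cancel₀ _ hpos.ne']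
      · rw [norm_smul, Real.norm_of_nonneg hpos.le, div_mul_eq_mul_div, div_le_iff₀ (by positivity)]
        nlinarith [norm_nonneg x]
  have hC : IsClosed C := by
    have hcd : Continuous fun x : EuclideanSpace ℝ (Fin 3) => δ / (1 + ‖x‖) :=
      continuous_const.div (by fun_prop) (fun x => by positivity)
    exact hclosed.preimage (continuous_const.add (hcd.smul continuous_id))
  have hadd : ∀ x ∈ C, ∀ y ∈ C, x + y ∈ C := by
    intro x hx y hy
    rw [hCiff] at hx hy ⊢
    obtain ⟨t, ht, hx⟩ := hx
    obtain ⟨u, hu, hy⟩ := hy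
    have hm : 0 < min t u := lt_min ht hu
    have hx' := hstar x _ hm.le _ (min_le_left t u) hx
    have hy' := hstar y _ hm.le _ (min_le_right t u) hy
    refine ⟨min t u / 2, by positivity, ?_⟩
    have := hconv hx' hy' (a := 1 / 2) (b := 1 / 2) (by norm_num) (by norm_num) (by norm_num)
    convert this using 1
    module
  have hsmul : ∀ c > (0 : ℝ), ∀ x ∈ C, c • x ∈ C := by
    intro c hc x hx
    rw [hCiff] at hx ⊢
    obtain ⟨t, ht, hx⟩ := hx
    refine ⟨t / c, by positivity, ?_⟩
    rwa [smul_smul, div_mul_cancel₀ _ hc.ne']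
  have hqC : q ∉ C := by
    rw [hCiff]
    rintro ⟨t, ht, h⟩
    have hmem : q ∈ openSegment ℝ 0 (q + t • q) := by
      refine ⟨t / (1 + t), 1 / (1 + t), by positivity, by positivity, by field_simp; ring, ?_⟩
      have : q + t • q = (1 + t) • q := by module
      rw [this, smul_zero, zero_add, smul_smul, one_div, inv_mul_cancel₀ (by positivity), one_smul]
    exact hq0 (hq.2 h0P h hmem).symm
  obtain ⟨ρ, hρ, hball⟩ := Metric.isOpen_iff.1 isOpen_interior _ h0
  have hint : ∀ x : EuclideanSpace ℝ (Fin 3), ‖x‖ ≤ ρ / 2 → -q + x ∈ C := by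
    intro x hx
    rw [hCiff]
    refine ⟨1, one_pos, ?_⟩
    rw [one_smul, add_neg_cancel_left]
    exact interior_subset (hball (by rw [mem_ball_zero_iff]; linarith))
  have key := cone_part C hC hadd hsmul q hqC (ρ / 2) (by positivity) hint
  have hT : ∀ v : EuclideanSpace ℝ (Fin 3),
      (∃ ε > (0 : ℝ), ∀ t ∈ Set.Icc (0 : ℝ) ε, q + t • v ∈ frontier P) ↔
      (v ∈ C ∧ ∀ s > (0 : ℝ), v + s • q ∉ C) := by
    intro v
    rw [hclosed.frontier_eq]
    constructor
    · rintro ⟨ε, hε, h⟩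
      refine ⟨(hCiff v).2 ⟨ε, hε, (h ε ⟨hε.le, le_rfl⟩).1⟩, ?_⟩
      intro s hs hmem
      rw [hCiff] at hmem
      obtain ⟨τ, hτ, hmem⟩ := hmem
      have hm : 0 < min τ ε := lt_min hτ hε
      have hmem' := hstar _ _ hm.le _ (min_le_left τ ε) hmem
      set m := min τ ε with hmdef
      have hmε : m ≤ ε := min_le_right _ _
      have hms : 0 < m * s := by positivity
      refine (h (m / (1 + m * s)) ⟨by positivity, ?_⟩).2 ?_
      · exact (div_le_self hm.le (by linarith)).trans hmε
      · have := hconv.combo_interior_self_mem_interior h0 hmem'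
          (a := m * s / (1 + m * s)) (b := 1 / (1 + m * s)) (by positivity) (by positivity)
          (by field_simp; ring)
        convert this using 1
        have e : q + m • (v + s • q) = (1 + m * s) • q + m • v := by module
        rw [e, smul_zero, zero_add, smul_add, smul_smul, smul_smul, one_div,
          inv_mul_cancel₀ (by positivity), one_smul, div_eq_inv_mul]
    · rintro ⟨hv, hs⟩
      have hpos : 0 < δ / (1 + ‖v‖) := by positivity
      refine ⟨δ / (1 + ‖v‖), hpos, ?_⟩
      rintro t ⟨ht0, ht1⟩
      refine ⟨hstar v t ht0 _ ht1 hv, ?_⟩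
      intro hin
      obtain ⟨r, hr, hb⟩ := Metric.isOpen_iff.1 isOpen_interior _ hin
      have hqn : 0 < ‖q‖ := norm_pos_iff.2 hq0
      have hη : 0 < r / (2 * ‖q‖) := by positivity
      have hm : q + t • v + (r / (2 * ‖q‖)) • q ∈ P := by
        apply interior_subset
        apply hb
        rw [Metric.mem_ball, dist_eq_norm, add_sub_cancel_left, norm_smul,
          Real.norm_of_nonneg hη.le]
        field_simp
        linarith
      rcases ht0.eq_or_lt with h | h
      · rw [← h, zero_smul, add_zero] at hm
        exact hqC ((hCiff q).2 ⟨_, hη, hm⟩)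
      · refine hs (r / (2 * ‖q‖) / t) (by positivity) ((hCiff _).2 ⟨t, h, ?_⟩)
        rwa [smul_add, smul_smul, mul_div_cancel₀ _ h.ne', ← add_assoc]
  simp only [hT]
  exact key
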